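/- Let G be an n×r matrix whose entries are i.i.d. standard Gaussian random variables, let u ∈ R^r, let v = (1/√n) G u ∈ R^n, and fix ε > 0. Then Probability{(1−ε)||u||^2 ≤ ||v||^2 ≤ (1+ε)||u||^2} ≥ 1 − 2 exp(−(ε^2 − ε^3) n / 4). -/

import Mathlib

open Matrix MeasureTheory ProbabilityTheory

/-- The law of an `n×r` matrix with i.i.d. standard Gaussian entries. -/
noncomputable def gaussianMatrix (n r : ℕ) : Measure (Fin n → Fin r → ℝ) :=
  Measure.pi fun _ => Measure.pi fun _ => gaussianReal 0 1


lemma jl_charFun_lin (r : ℕ) (w : Fin r → ℝ) (hw : ∑ i, (w i)^2 = 1) :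
    (Measure.pi fun _ : Fin r => gaussianReal 0 1).map (fun x => ∑ i, x i * w i)
      = gaussianReal 0 1 := by
  have hm : Measurable (fun x : Fin r → ℝ => ∑ i, x i * w i) := by fun_prop
  have := Measure.isProbabilityMeasure_map (μ := Measure.pi fun _ : Fin r => gaussianReal 0 1)
    hm.aemeasurable
  apply Measure.ext_of_charFun
  ext t
  rw [charFun_apply_real, integral_map hm.aemeasurable (by fun_prop)]
  have h := charFun_pi (μ := fun _ : Fin r => gaussianReal 0 1)
    (WithLp.toLp 2 (fun i => t * w i))
  rw [charFun_apply, ← MeasurableEquiv.coe_toLp, integral_map_equiv] at h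
  calc _ = _ := ?_
    _ = _ := h
    _ = _ := ?_
  · congr 1
    ext x
    congr 2
    simp only [MeasurableEquiv.coe_toLp, PiLp.inner_apply]
    simp [Finset.mul_sum]
    refine Finset.sum_congr rfl fun i _ => ?_
    ring
  · simp only [charFun_gaussianReal]
    rw [← Complex.exp_sum]
    congr 1
    have h2 : ∑ i, ((w i : ℂ))^2 = 1 := by exact_mod_cast hw
    simp only [Complex.ofReal_zero, mul_zero, zero_mul, zero_sub, NNReal.coe_one,
      Complex.ofReal_one, one_mul, MeasurableEquiv.coe_toLp, Complex.ofReal_mul, mul_pow]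
    rw [Finset.sum_neg_distrib, ← Finset.sum_div, ← Finset.mul_sum, h2, mul_one]

lemma jl_mgf_sq (a : ℝ) (ha : 0 < a) :
    mgf (fun x : ℝ => x^2) (gaussianReal 0 1) ((1 - a⁻¹) / 2) = √a := by
  rw [mgf, integral_gaussianReal_eq_integral_smul one_ne_zero]
  have h : ∀ x : ℝ, gaussianPDFReal 0 1 x • Real.exp ((1 - a⁻¹) / 2 * x^2)
      = (√(2 * Real.pi))⁻¹ * Real.exp (-(a⁻¹ / 2) * x^2) := by
    intro x
    simp only [gaussianPDFReal, smul_eq_mul, NNReal.coe_one, mul_one, sub_zero]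
    rw [mul_assoc, ← Real.exp_add]
    congr 2
    ring
  simp_rw [h]
  rw [integral_const_mul, integral_gaussian, ← Real.sqrt_inv, ← Real.sqrt_mul (by positivity)]
  congr 1
  field_simp

lemma jl_mgf_sum (n : ℕ) (a : ℝ) (ha : 0 < a) :
    mgf (fun y : Fin n → ℝ => ∑ j, (y j)^2) (Measure.pi fun _ : Fin n => gaussianReal 0 1)
      ((1 - a⁻¹) / 2) = (√a)^n := by
  have hind : iIndepFun (fun (j : Fin n) (y : Fin n → ℝ) => (y j)^2)
      (Measure.pi fun _ : Fin n => gaussianReal 0 1) :=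
    iIndepFun_pi (X := fun (_ : Fin n) (x : ℝ) => x^2) (fun _ => by fun_prop)
  have h := hind.mgf_sum (t := (1 - a⁻¹) / 2) (fun _ => by fun_prop) Finset.univ
  have e : (fun y : Fin n → ℝ => ∑ j, (y j)^2)
      = ∑ j, (fun (j : Fin n) (y : Fin n → ℝ) => (y j)^2) j := by
    ext y; simp
  rw [e, h]
  have : ∀ j : Fin n, mgf (fun y : Fin n → ℝ => (y j)^2)
      (Measure.pi fun _ : Fin n => gaussianReal 0 1) ((1 - a⁻¹) / 2) = √a := by
    intro j
    have hj := (measurePreserving_eval (fun _ : Fin n => gaussianReal 0 1) j).map_eq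
    have hq := jl_mgf_sq a ha
    rw [mgf, ← hj, integral_map (measurable_pi_apply j).aemeasurable (by fun_prop)] at hq
    exact hq
  simp [this]

lemma jl_const (n : ℕ) (a c : ℝ) (ha : 0 < a) (h : Real.log a ≤ a - 1 - c) :
    Real.exp (-((1 - a⁻¹) / 2) * (a * n)) * (√a)^n ≤ Real.exp (-c * n / 2) := by
  have e : √a = Real.exp (Real.log a / 2) := by
    rw [← Real.log_sqrt ha.le, Real.exp_log (Real.sqrt_pos.2 ha)]
  rw [e, ← Real.exp_nat_mul, ← Real.exp_add, Real.exp_le_exp]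
  have e2 : -((1 - a⁻¹) / 2) * (a * n) = -(a - 1) / 2 * n := by field_simp
  rw [e2]
  have := mul_le_mul_of_nonneg_left h (Nat.cast_nonneg (α := ℝ) n)
  linarith

lemma jl_int (n : ℕ) (a : ℝ) (ha : 0 < a) :
    Integrable (fun y : Fin n → ℝ => Real.exp ((1 - a⁻¹) / 2 * ∑ j, (y j)^2))
      (Measure.pi fun _ : Fin n => gaussianReal 0 1) := by
  have := jl_mgf_sum n a ha
  exact mgf_pos_iff.1 (by rw [this]; positivity)

lemma jl_log_upper (ε : ℝ) (h0 : 0 < ε) (h1 : ε < 1) :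
    Real.log (1 + ε) ≤ (1 + ε) - 1 - (ε^2 - ε^3) / 2 := by
  rw [Real.log_le_iff_le_exp (by linarith)]
  have hx : 0 ≤ (1 + ε) - 1 - (ε^2 - ε^3) / 2 := by nlinarith [pow_pos h0 3]
  refine le_trans ?_ (Real.quadratic_le_exp_of_nonneg hx)
  have : ε^2 - ε^3 ≤ ((1 + ε) - 1 - (ε^2 - ε^3) / 2)^2 := by
    have : ((1 + ε) - 1 - (ε^2 - ε^3) / 2)^2 - (ε^2 - ε^3)
      = ε^4 + (ε^2 - ε^3)^2 / 4 := by ring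
    have : 0 ≤ ε^4 + (ε^2 - ε^3)^2 / 4 := by positivity
    linarith
  linarith

lemma jl_log_lower (ε : ℝ) (h0 : 0 < ε) (h1 : ε < 1) :
    Real.log (1 - ε) ≤ (1 - ε) - 1 - (ε^2 - ε^3) / 2 := by
  have h := Real.hasSum_pow_div_log_of_abs_lt_one (x := ε) (by rw [abs_of_pos h0]; exact h1)
  have := sum_le_hasSum (Finset.range 2) (fun i _ => by positivity) h
  norm_num [Finset.sum_range_succ] at this
  have := pow_pos h0 3
  linarith

lemma jl_meas (n : ℕ) (ε : ℝ) : MeasurableSet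
    {y : Fin n → ℝ | (1 - ε) * n ≤ ∑ j, (y j)^2 ∧ ∑ j, (y j)^2 ≤ (1 + ε) * n} := by
  have h : Measurable (fun y : Fin n → ℝ => ∑ j, (y j)^2) := by fun_prop
  exact (measurableSet_le measurable_const h).inter (measurableSet_le h measurable_const)

lemma jl_chi (n : ℕ) (ε : ℝ) (h0 : 0 < ε) (h1 : ε < 1) :
    (Measure.pi fun _ : Fin n => gaussianReal 0 1).real
      {y | (1 - ε) * n ≤ ∑ j, (y j)^2 ∧ ∑ j, (y j)^2 ≤ (1 + ε) * n}
      ≥ 1 - 2 * Real.exp (-(ε^2 - ε^3) * n / 4) := by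
  set P := (Measure.pi fun _ : Fin n => gaussianReal 0 1)
  set S := {y : Fin n → ℝ | (1 - ε) * n ≤ ∑ j, (y j)^2 ∧ ∑ j, (y j)^2 ≤ (1 + ε) * n}
  have hS : MeasurableSet S := jl_meas n ε
  have hup : P.real {y | (1 + ε) * n ≤ ∑ j, (y j)^2} ≤ Real.exp (-(ε^2 - ε^3) * n / 4) := by
    have ha : 0 < 1 + ε := by linarith
    refine (measure_ge_le_exp_mul_mgf _ ?_ (jl_int n (1 + ε) ha)).trans ?_
    · have : (1 + ε)⁻¹ ≤ 1 := inv_le_one_of_one_le₀ (by linarith)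
      linarith
    · rw [jl_mgf_sum n _ ha]
      refine (jl_const n _ _ ha (jl_log_upper ε h0 h1)).trans (le_of_eq ?_)
      congr 1; ring
  have hlo : P.real {y | ∑ j, (y j)^2 ≤ (1 - ε) * n} ≤ Real.exp (-(ε^2 - ε^3) * n / 4) := by
    have ha : 0 < 1 - ε := by linarith
    refine (measure_le_le_exp_mul_mgf _ ?_ (jl_int n (1 - ε) ha)).trans ?_
    · have : 1 ≤ (1 - ε)⁻¹ := (one_le_inv₀ ha).2 (by linarith)
      linarith
    · rw [jl_mgf_sum n _ ha]
      refine (jl_const n _ _ ha (jl_log_lower ε h0 h1)).trans (le_of_eq ?_)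
      congr 1; ring
  have hc : P.real Sᶜ ≤ P.real {y | ∑ j, (y j)^2 ≤ (1 - ε) * n}
      + P.real {y | (1 + ε) * n ≤ ∑ j, (y j)^2} := by
    refine (measureReal_mono ?_).trans (measureReal_union_le _ _)
    intro y hy
    by_contra hcon
    apply hy
    simp only [Set.mem_union, Set.mem_ofPred_eq, not_or, not_le] at hcon
    exact ⟨hcon.1.le, hcon.2.le⟩
  have := probReal_compl_eq_one_sub (μ := P) hS
  linarith

/-- Johnson–Lindenstrauss norm concentration: for an `n×r` Gaussian matrix `G`, a fixed
`u ∈ ℝʳ` and `v = (1/√n) G u`, with probability at least `1 − 2 exp(−(ε²−ε³)n/4)` the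
squared norm of `v` is within relative error `ε` of that of `u`. -/
theorem jl_norm_concentration (n r : ℕ) (u : Fin r → ℝ) (ε : ℝ) (hε : 0 < ε) :
    gaussianMatrix n r {g |
      (1 - ε) * (∑ i, (u i)^2) ≤ ∑ j, ((1 / Real.sqrt n) * (Matrix.of g).mulVec u j)^2 ∧
      (∑ j, ((1 / Real.sqrt n) * (Matrix.of g).mulVec u j)^2) ≤ (1 + ε) * (∑ i, (u i)^2)}
    ≥ ENNReal.ofReal (1 - 2 * Real.exp (-(ε^2 - ε^3) * n / 4)) := by
  rcases le_or_gt 1 ε with h1 | h1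
  · have : 1 ≤ Real.exp (-(ε^2 - ε^3) * n / 4) := by
      apply Real.one_le_exp
      have : 0 ≤ ε^2 * (ε - 1) * n := by
        have := sub_nonneg.2 h1
        positivity
      linarith
    rw [ENNReal.ofReal_of_nonpos (by linarith)]
    exact zero_le
  rcases Nat.eq_zero_or_pos n with rfl | hn
  · rw [ENNReal.ofReal_of_nonpos (by norm_num)]
    exact zero_le
  have : IsProbabilityMeasure (gaussianMatrix n r) := by
    unfold gaussianMatrix; infer_instance
  by_cases hu : ∑ i, (u i)^2 = 0
  · have hu0 : u = 0 := by
      ext i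
      have := (Finset.sum_eq_zero_iff_of_nonneg (fun i _ => sq_nonneg (u i))).1 hu i
        (Finset.mem_univ i)
      simpa using this
    subst hu0
    simp only [Matrix.mulVec_zero]
    simp
    positivity
  have hs : 0 < ∑ i, (u i)^2 :=
    lt_of_le_of_ne (Finset.sum_nonneg fun i _ => sq_nonneg _) (Ne.symm hu)
  set s := ∑ i, (u i)^2 with hsdef
  have hsq : (√s)^2 = s := Real.sq_sqrt hs.le
  have hs' : 0 < √s := Real.sqrt_pos.2 hs
  have hw : ∑ i, (u i / √s)^2 = 1 := by
    simp_rw [div_pow, hsq]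
    rw [← Finset.sum_div, ← hsdef, div_self hu]
  have hlaw := jl_charFun_lin r (fun i => u i / √s) hw
  have hmap : (gaussianMatrix n r).map (fun g j => ∑ i, g j i * (u i / √s))
      = Measure.pi fun _ : Fin n => gaussianReal 0 1 := by
    unfold gaussianMatrix
    have : ∀ i : Fin n, SigmaFinite ((Measure.pi fun _ : Fin r => gaussianReal 0 1).map
        (fun x => ∑ i, x i * (u i / √s))) := fun _ => by
      rw [hlaw]; infer_instance
    rw [Measure.pi_map_pi (f := fun (_ : Fin n) (x : Fin r → ℝ) => ∑ i, x i * (u i / √s))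
      (fun _ => Measurable.aemeasurable (by fun_prop))]
    simp_rw [hlaw]
  have key := jl_chi n ε hε h1
  rw [← hmap, map_measureReal_apply (by fun_prop)
    (jl_meas n ε)] at key
  refine (ENNReal.ofReal_le_ofReal key).trans ?_
  rw [ofReal_measureReal]
  apply measure_mono
  intro g hg
  obtain ⟨hg1, hg2⟩ := hg
  have hn' : (0 : ℝ) < n := by exact_mod_cast hn
  have e : ∑ j, ((1 / √(n : ℝ)) * (Matrix.of g).mulVec u j)^2
      = s / n * ∑ j, (∑ i, g j i * (u i / √s))^2 := by
    rw [Finset.mul_sum]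
    refine Finset.sum_congr rfl fun j _ => ?_
    have : ∑ i, g j i * (u i / √s) = (Matrix.of g).mulVec u j / √s := by
      simp [Matrix.mulVec, dotProduct, Finset.sum_div, mul_div_assoc]
    rw [this, mul_pow, div_pow, div_pow, hsq, Real.sq_sqrt hn'.le]
    field_simp
  have hp : 0 ≤ s / n := by positivity
  rw [Set.mem_ofPred_eq, e]
  constructor
  · calc (1 - ε) * s = s / n * ((1 - ε) * n) := by field_simp
      _ ≤ _ := mul_le_mul_of_nonneg_left hg1 hp
  · calc _ ≤ s / n * ((1 + ε) * n) := mul_le_mul_of_nonneg_left hg2 hp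
      _ = _ := by field_simp
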